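/- For every ε ∈ (0,1) there exists a constant C > 0 such that for all integers n ≥ 2, all Δ ∈ (0, 1-ε], and all horizons t ∈ ℕ with t ≤ 1/Δ², the optimal mutual information satisfies I*_t ≤ C·t·Δ²/n. -/

import Mathlib

open scoped BigOperators

noncomputable section

/-- Probability that pulling arm `a` yields reward `r : Bool` (with `true` = reward 1),
when the best arm is `astar`: `Bernoulli ((1+Δ)/2)` if `a = astar`, else `Bernoulli ((1-Δ)/2)`. -/
def rewP (n : ℕ) (Δ : ℝ) (astar a : Fin n) (r : Bool) : ℝ :=
  if r then (if a = astar then (1 + Δ) / 2 else (1 - Δ) / 2)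
  else 1 - (if a = astar then (1 + Δ) / 2 else (1 - Δ) / 2)

/-- An interactive algorithm: for every history (recorded with the most recent pull first),
a probability distribution over the `n` arms used to draw the next pull. -/
def IsAlg (n : ℕ) (alg : List (Fin n × Bool) → Fin n → ℝ) : Prop :=
  ∀ h : List (Fin n × Bool), (∀ a, 0 ≤ alg h a) ∧ (∑ a : Fin n, alg h a) = 1

/-- Probability, conditionally on the best arm `astar`, of observing a given history
(recorded with the most recent pull first) when running the algorithm `alg`. -/
def histP (n : ℕ) (alg : List (Fin n × Bool) → Fin n → ℝ) (Δ : ℝ) (astar : Fin n) :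
    List (Fin n × Bool) → ℝ
  | [] => 1
  | (a, r) :: prev => histP n alg Δ astar prev * alg prev a * rewP n Δ astar a r

/-- The reversed history (most recent pull first) associated with a tuple of `t` pulls. -/
def hist {n t : ℕ} (h : Fin t → Fin n × Bool) : List (Fin n × Bool) :=
  (List.ofFn h).reverse

/-- Success probability `P(a_{t+1} = a*)` of an interactive algorithm after `t` rounds,
under the uniform prior on the best arm. -/
def succProb (n t : ℕ) (alg : List (Fin n × Bool) → Fin n → ℝ) (Δ : ℝ) : ℝ :=
  ((n : ℝ))⁻¹ * ∑ astar : Fin n, ∑ h : Fin t → Fin n × Bool,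
    histP n alg Δ astar (hist h) * alg (hist h) astar

/-- Mutual information (in nats) `I(a*; H_t)` accumulated by an interactive algorithm. -/
def mutualInfo (n t : ℕ) (alg : List (Fin n × Bool) → Fin n → ℝ) (Δ : ℝ) : ℝ :=
  ∑ astar : Fin n, ∑ h : Fin t → Fin n × Bool,
    ((n : ℝ))⁻¹ * histP n alg Δ astar (hist h) *
      Real.log (histP n alg Δ astar (hist h) /
        (((n : ℝ))⁻¹ * ∑ b : Fin n, histP n alg Δ b (hist h)))

/-- Optimal success probability `p*_t`. -/
def pStar (n t : ℕ) (Δ : ℝ) : ℝ :=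
  sSup {x : ℝ | ∃ alg, IsAlg n alg ∧ x = succProb n t alg Δ}

/-- Optimal mutual information `I*_t`. -/
def IStar (n t : ℕ) (Δ : ℝ) : ℝ :=
  sSup {x : ℝ | ∃ alg, IsAlg n alg ∧ x = mutualInfo n t alg Δ}

/-- Probability of a history when no arm is better than the others, so that every reward is
`Bernoulli ((1-Δ)/2)`. -/
def nullP (n : ℕ) (alg : List (Fin n × Bool) → Fin n → ℝ) (Δ : ℝ) :
    List (Fin n × Bool) → ℝ
  | [] => 1
  | (a, r) :: prev => nullP n alg Δ prev * alg prev a * (if r then (1 - Δ) / 2 else (1 + Δ) / 2)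

/-- Likelihood ratio of a history under best arm `astar` against the null model `nullP`. -/
def likRatio (n : ℕ) (Δ : ℝ) (astar : Fin n) : List (Fin n × Bool) → ℝ
  | [] => 1
  | (a, r) :: prev => likRatio n Δ astar prev *
      (if astar = a then (if r then (1 + Δ) / (1 - Δ) else (1 - Δ) / (1 + Δ)) else 1)

/-- Squared deviation of the likelihood ratios from `1`, summed over the arms. -/
def likDev (n : ℕ) (Δ : ℝ) (h : List (Fin n × Bool)) : ℝ :=
  ∑ a, (likRatio n Δ a h - 1) ^ 2

section

variable {n : ℕ} {alg : List (Fin n × Bool) → Fin n → ℝ} {Δ : ℝ}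

lemma likDev_nonneg (h : List (Fin n × Bool)) : 0 ≤ likDev n Δ h :=
  Finset.sum_nonneg fun _ _ => sq_nonneg _

lemma nullP_nonneg (halg : IsAlg n alg) (h0 : 0 < Δ) (h1 : Δ < 1) (h : List (Fin n × Bool)) :
    0 ≤ nullP n alg Δ h := by
  induction h with
  | nil => simp [nullP]
  | cons x prev ih =>
    obtain ⟨a, r⟩ := x
    have hr : (0 : ℝ) ≤ if r then (1 - Δ) / 2 else (1 + Δ) / 2 := by split_ifs <;> linarith
    exact mul_nonneg (mul_nonneg ih ((halg prev).1 a)) hr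

lemma likRatio_pos (h0 : 0 < Δ) (h1 : Δ < 1) (a : Fin n) (h : List (Fin n × Bool)) :
    0 < likRatio n Δ a h := by
  have hm : 0 < 1 - Δ := by linarith
  have hp : 0 < 1 + Δ := by linarith
  induction h with
  | nil => simp [likRatio]
  | cons x prev ih =>
    obtain ⟨b, r⟩ := x
    refine mul_pos ih ?_
    split_ifs <;> positivity

lemma histP_eq_nullP_mul (h0 : 0 < Δ) (h1 : Δ < 1) (a : Fin n) (h : List (Fin n × Bool)) :
    histP n alg Δ a h = nullP n alg Δ h * likRatio n Δ a h := by
  have hm : 1 - Δ ≠ 0 := by linarith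
  have hp : 1 + Δ ≠ 0 := by linarith
  induction h with
  | nil => simp [histP, nullP, likRatio]
  | cons x prev ih =>
    obtain ⟨b, r⟩ := x
    rw [histP, nullP, likRatio, ih, rewP]
    by_cases hb : b = a
    · subst hb
      cases r <;> simp <;> field_simp <;> ring
    · have hb' : a ≠ b := fun e => hb e.symm
      cases r <;> simp [hb, hb'] <;> ring

lemma sum_hist_succ (t : ℕ) (f : List (Fin n × Bool) → ℝ) :
    ∑ h : Fin (t + 1) → Fin n × Bool, f (hist h) =
      ∑ h : Fin t → Fin n × Bool, ∑ x : Fin n × Bool, f (x :: hist h) := by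
  rw [← (Fin.snocEquiv fun _ : Fin (t + 1) => Fin n × Bool).sum_comp, Fintype.sum_prod_type,
    Finset.sum_comm]
  refine Finset.sum_congr rfl fun h _ => Finset.sum_congr rfl fun x _ => ?_
  congr 1
  simp only [hist, Fin.snocEquiv, Equiv.coe_fn_mk, List.ofFn_succ', Fin.snoc_castSucc,
    Fin.snoc_last, List.concat_eq_append, List.reverse_append]
  rfl

lemma sum_nullP_cons (halg : IsAlg n alg) (h : List (Fin n × Bool)) :
    ∑ x : Fin n × Bool, nullP n alg Δ (x :: h) = nullP n alg Δ h := by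
  rw [Fintype.sum_prod_type]
  have hb : ∀ b, ∑ r, nullP n alg Δ ((b, r) :: h) = nullP n alg Δ h * alg h b := by
    intro b
    simp only [Fintype.sum_bool, nullP]
    simp
    ring
  rw [Finset.sum_congr rfl fun b _ => hb b, ← Finset.mul_sum, (halg h).2, mul_one]

lemma sum_nullP (halg : IsAlg n alg) (t : ℕ) :
    ∑ h : Fin t → Fin n × Bool, nullP n alg Δ (hist h) = 1 := by
  induction t with
  | zero => simp [hist, nullP]
  | succ t ih =>
    rw [sum_hist_succ t (nullP n alg Δ)]
    simpa only [sum_nullP_cons halg] using ih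

lemma likDev_cons (b : Fin n) (r : Bool) (h : List (Fin n × Bool)) :
    likDev n Δ ((b, r) :: h) = likDev n Δ h +
      ((likRatio n Δ b h * (if r then (1 + Δ) / (1 - Δ) else (1 - Δ) / (1 + Δ)) - 1) ^ 2
        - (likRatio n Δ b h - 1) ^ 2) := by
  have hterm : ∀ a, (likRatio n Δ a ((b, r) :: h) - 1) ^ 2 = (likRatio n Δ a h - 1) ^ 2 +
      if a = b then
        (likRatio n Δ b h * (if r then (1 + Δ) / (1 - Δ) else (1 - Δ) / (1 + Δ)) - 1) ^ 2
          - (likRatio n Δ b h - 1) ^ 2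
      else 0 := by
    intro a
    rw [likRatio]
    by_cases hab : a = b
    · subst hab
      simp
    · simp [hab]
  rw [likDev, Finset.sum_congr rfl fun a _ => hterm a, Finset.sum_add_distrib, likDev]
  simp

lemma sum_nullP_mul_likDev_cons_le (halg : IsAlg n alg) (h0 : 0 < Δ) (h1 : Δ < 1)
    (h : List (Fin n × Bool)) :
    ∑ x : Fin n × Bool, nullP n alg Δ (x :: h) * (1 + likDev n Δ (x :: h)) ≤
      (1 + 8 * Δ ^ 2 / (1 - Δ ^ 2)) * (nullP n alg Δ h * (1 + likDev n Δ h)) := by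
  have hm : 0 < 1 - Δ := by linarith
  have hp : 0 < 1 + Δ := by linarith
  have hmp : 0 < 1 - Δ ^ 2 := by nlinarith
  have hN := nullP_nonneg halg h0 h1 h
  rw [Fintype.sum_prod_type]
  have hb : ∀ b, ∑ r, nullP n alg Δ ((b, r) :: h) * (1 + likDev n Δ ((b, r) :: h)) =
      nullP n alg Δ h * alg h b *
        (1 + likDev n Δ h + 4 * Δ ^ 2 / (1 - Δ ^ 2) * likRatio n Δ b h ^ 2) := by
    intro b
    simp only [Fintype.sum_bool, nullP, likDev_cons, if_true, Bool.false_eq_true, if_false]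
    generalize likRatio n Δ b h = L
    generalize likDev n Δ h = S
    rw [show 1 - Δ ^ 2 = (1 - Δ) * (1 + Δ) by ring]
    field_simp
    ring
  have hle : ∀ b, nullP n alg Δ h * alg h b *
        (1 + likDev n Δ h + 4 * Δ ^ 2 / (1 - Δ ^ 2) * likRatio n Δ b h ^ 2) ≤
      (1 + 8 * Δ ^ 2 / (1 - Δ ^ 2)) * (nullP n alg Δ h * (1 + likDev n Δ h)) * alg h b := by
    intro b
    have hS : (likRatio n Δ b h - 1) ^ 2 ≤ likDev n Δ h :=
      Finset.single_le_sum (f := fun a => (likRatio n Δ a h - 1) ^ 2)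
        (fun _ _ => sq_nonneg _) (Finset.mem_univ b)
    have hL : likRatio n Δ b h ^ 2 ≤ 2 * (1 + likDev n Δ h) := by
      nlinarith [sq_nonneg (likRatio n Δ b h - 2)]
    have hk : 0 ≤ 4 * Δ ^ 2 / (1 - Δ ^ 2) := by positivity
    calc _ ≤ nullP n alg Δ h * alg h b *
          (1 + likDev n Δ h + 4 * Δ ^ 2 / (1 - Δ ^ 2) * (2 * (1 + likDev n Δ h))) := by
          have := mul_nonneg hN ((halg h).1 b)
          gcongr
      _ = _ := by ring
  rw [Finset.sum_congr rfl fun b _ => hb b]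
  refine (Finset.sum_le_sum fun b _ => hle b).trans_eq ?_
  rw [← Finset.mul_sum, (halg h).2, mul_one]

lemma sum_nullP_mul_likDev_le (halg : IsAlg n alg) (h0 : 0 < Δ) (h1 : Δ < 1) (t : ℕ) :
    ∑ h : Fin t → Fin n × Bool, nullP n alg Δ (hist h) * (1 + likDev n Δ (hist h)) ≤
      (1 + 8 * Δ ^ 2 / (1 - Δ ^ 2)) ^ t := by
  have hmp : 0 < 1 - Δ ^ 2 := by nlinarith
  induction t with
  | zero => simp [hist, nullP, likDev, likRatio]
  | succ t ih =>
    rw [sum_hist_succ t fun l => nullP n alg Δ l * (1 + likDev n Δ l), pow_succ']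
    refine (Finset.sum_le_sum fun h _ =>
      sum_nullP_mul_likDev_cons_le halg h0 h1 (hist h)).trans ?_
    rw [← Finset.mul_sum]
    gcongr

/-- Replacing the mixture by the reference measure `1` and Kullback-Leibler by chi-squared,
pointwise. -/
lemma sum_mul_log_div_mean_le (hn : 0 < n) (L : Fin n → ℝ) (hL : ∀ a, 0 < L a) :
    ∑ a, L a * Real.log (L a / ((n : ℝ)⁻¹ * ∑ b, L b)) ≤ ∑ a, (L a - 1) ^ 2 := by
  have hn' : (0 : ℝ) < n := by exact_mod_cast hn
  have : NeZero n := ⟨hn.ne'⟩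
  have hsum : 0 < ∑ b, L b := Finset.sum_pos (fun b _ => hL b) Finset.univ_nonempty
  set M := (n : ℝ)⁻¹ * ∑ b, L b with hM
  have hMpos : 0 < M := by positivity
  have hsumM : ∑ b, L b = n * M := by rw [hM]; field_simp
  have hlogM : M - 1 ≤ M * Real.log M := by
    have := mul_le_mul_of_nonneg_left (Real.one_sub_inv_le_log_of_pos hMpos) hMpos.le
    rwa [mul_sub, mul_one, mul_inv_cancel₀ hMpos.ne'] at this
  have hterm : ∀ a, L a * Real.log (L a / M) ≤ L a * (L a - 1) - L a * Real.log M := by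
    intro a
    rw [Real.log_div (hL a).ne' hMpos.ne', mul_sub]
    have := mul_le_mul_of_nonneg_left (Real.log_le_sub_one_of_pos (hL a)) (hL a).le
    linarith
  refine (Finset.sum_le_sum fun a _ => hterm a).trans ?_
  have hsq : ∑ a, (L a - 1) ^ 2 = ∑ a, L a * (L a - 1) - ∑ a, L a + n := by
    rw [← Finset.sum_sub_distrib, ← sub_eq_iff_eq_add]
    have : (n : ℝ) = ∑ _a : Fin n, (1 : ℝ) := by simp
    rw [this, ← Finset.sum_sub_distrib]
    exact Finset.sum_congr rfl fun a _ => by ring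
  rw [Finset.sum_sub_distrib, ← Finset.sum_mul, hsq, hsumM]
  nlinarith

lemma mutualInfo_le_sum_likDev (hn : 0 < n) (halg : IsAlg n alg) (h0 : 0 < Δ) (h1 : Δ < 1)
    (t : ℕ) :
    mutualInfo n t alg Δ ≤
      (n : ℝ)⁻¹ * ∑ h : Fin t → Fin n × Bool, nullP n alg Δ (hist h) * likDev n Δ (hist h) := by
  rw [mutualInfo, Finset.sum_comm, Finset.mul_sum]
  refine Finset.sum_le_sum fun h _ => ?_
  simp only [histP_eq_nullP_mul h0 h1]
  rcases (nullP_nonneg halg h0 h1 (hist h)).eq_or_lt with hN | hN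
  · simp [← hN]
  have hterm : ∀ a, (n : ℝ)⁻¹ * (nullP n alg Δ (hist h) * likRatio n Δ a (hist h)) *
      Real.log (nullP n alg Δ (hist h) * likRatio n Δ a (hist h) /
        ((n : ℝ)⁻¹ * ∑ b, nullP n alg Δ (hist h) * likRatio n Δ b (hist h))) =
      (n : ℝ)⁻¹ * nullP n alg Δ (hist h) * (likRatio n Δ a (hist h) *
        Real.log (likRatio n Δ a (hist h) / ((n : ℝ)⁻¹ * ∑ b, likRatio n Δ b (hist h)))) := by
    intro a
    rw [← Finset.mul_sum, mul_left_comm (n : ℝ)⁻¹ (nullP n alg Δ (hist h)) (∑ b, likRatio n Δ b (hist h)),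
      mul_div_mul_left _ _ hN.ne']
    ring
  rw [Finset.sum_congr rfl fun a _ => hterm a, ← Finset.mul_sum, ← mul_assoc]
  exact mul_le_mul_of_nonneg_left
    (sum_mul_log_div_mean_le hn _ fun a => likRatio_pos h0 h1 a _) (by positivity)

end

/-- Converse for the mutual information at small `t`: for every `ε ∈ (0,1)` there is `C > 0`
such that for all `n ≥ 2`, `Δ ∈ (0, 1-ε]` and horizons `t ≤ 1/Δ²`, `I*_t ≤ C t Δ² / n`. -/
theorem bandit_info_converse_small_t :
    ∀ ε : ℝ, ε ∈ Set.Ioo (0 : ℝ) 1 → ∃ C : ℝ, 0 < C ∧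
      ∀ n : ℕ, 2 ≤ n → ∀ Δ : ℝ, Δ ∈ Set.Ioc (0 : ℝ) (1 - ε) →
        ∀ t : ℕ, (t : ℝ) ≤ 1 / Δ ^ 2 →
          IStar n t Δ ≤ C * t * Δ ^ 2 / n := by
  rintro ε ⟨hε, hε1⟩
  refine ⟨8 / ε * Real.exp (8 / ε), by positivity, fun n hn Δ hΔ t ht => ?_⟩
  obtain ⟨h0, hΔε⟩ := hΔ
  have h1 : Δ < 1 := by linarith
  have hgap : ε ≤ 1 - Δ ^ 2 := by nlinarith
  have htΔ : t * Δ ^ 2 ≤ 1 := by rwa [le_div_iff₀ (by positivity)] at ht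
  refine Real.sSup_le ?_ (by positivity)
  rintro _ ⟨alg, halg, rfl⟩
  refine (mutualInfo_le_sum_likDev (by omega) halg h0 h1 t).trans ?_
  have hW := sum_nullP_mul_likDev_le halg h0 h1 t
  simp only [mul_add, mul_one, Finset.sum_add_distrib, sum_nullP halg] at hW
  set y := 8 / ε * (t * Δ ^ 2) with hy
  have hy0 : 0 ≤ y := by positivity
  have hyle : y ≤ 8 / ε := mul_le_of_le_one_right (by positivity) htΔ
  have hpow : (1 + 8 * Δ ^ 2 / (1 - Δ ^ 2)) ^ t ≤ Real.exp y := by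
    calc (1 + 8 * Δ ^ 2 / (1 - Δ ^ 2)) ^ t ≤ (Real.exp (8 * Δ ^ 2 / ε)) ^ t := by
          have hpos : 0 < 1 - Δ ^ 2 := by linarith
          refine pow_le_pow_left₀ (by positivity) ?_ t
          have : 8 * Δ ^ 2 / (1 - Δ ^ 2) ≤ 8 * Δ ^ 2 / ε := by gcongr
          linarith [Real.add_one_le_exp (8 * Δ ^ 2 / ε)]
      _ = Real.exp y := by
          rw [← Real.exp_nat_mul, hy]
          congr 1
          ring
  have hexp : Real.exp y - 1 ≤ y * Real.exp y := by
    have := mul_le_mul_of_nonneg_right (Real.add_one_le_exp (-y)) (Real.exp_pos y).le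
    rw [← Real.exp_add, neg_add_cancel, Real.exp_zero] at this
    linarith
  have hexp' : y * Real.exp y ≤ y * Real.exp (8 / ε) := by gcongr
  calc _ ≤ (n : ℝ)⁻¹ * (y * Real.exp (8 / ε)) :=
        mul_le_mul_of_nonneg_left (by linarith) (by positivity)
    _ = _ := by
        rw [hy, div_eq_mul_inv _ (n : ℝ)]
        ring
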